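/- arXiv:2211.05639 — 3 statements merged into one kernel-verified Lean document; each statement's English description precedes it below -/
import Mathlib

section
/- Let Σ ∈ ℝ^{n×n} be symmetric positive definite, μ₁ ∈ ℝ^{n}, q > 0, and ℓ_1, …, ℓ_n > 0. Then there exist a symmetric positive-definite matrix Δ₁ ∈ ℝ^{n×n}, a vector Δ₂ ∈ ℝ^{n}, and scalars η₀, η₁, …, η_n ≥ 0 such that, with W = diag(η_1/(ℓ_1/2)², …, η_n/(ℓ_n/2)²) and Δ₃ = Δ₂ᵀΔ₁^{-1}Δ₂ − 1, the symmetric (2n+1)×(2n+1) block matrix −[[Δ₁, 0, Δ₂],[0, 0, 0],[Δ₂ᵀ, 0, Δ₃]] + [[0, 0, 0],[0, W, −Wμ₁],[0, −μ₁ᵀW, μ₁ᵀWμ₁ − ∑_{i=1}^{n} η_i]] + η₀[[Σ^{-1}, −Σ^{-1}, 0],[−Σ^{-1}, Σ^{-1}, 0],[0, 0, −q]] is positive semidefinite. -/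
open Matrix Finset

/-- Column block: a vector `v` viewed as a one-column matrix. -/
def colBlk {m : Type*} (v : m → ℝ) : Matrix m (Fin 1) ℝ := Matrix.of fun i _ => v i

/-- Row block: a vector `v` viewed as a one-row matrix. -/
def rowBlk {m : Type*} (v : m → ℝ) : Matrix (Fin 1) m ℝ := Matrix.of fun _ j => v j

/-- Scalar block: a real `c` viewed as a `1 × 1` matrix. -/
def sclBlk (c : ℝ) : Matrix (Fin 1) (Fin 1) ℝ := Matrix.of fun _ _ => c

/-- The symmetric `(2n+1) × (2n+1)` block matrix (blocks of sizes `n, n, 1`)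
`−[[Δ₁, 0, Δ₂],[0, 0, 0],[Δ₂ᵀ, 0, Δ₃]]
 + [[0, 0, 0],[0, W, −Wμ₁],[0, −μ₁ᵀW, μ₁ᵀWμ₁ − ∑ηᵢ]]
 + η₀ [[Σ⁻¹, −Σ⁻¹, 0],[−Σ⁻¹, Σ⁻¹, 0],[0, 0, −q]]`
appearing in the LMI (9) of the paper; `Sinv` stands for `Σ⁻¹`. -/
noncomputable def lmiMatrix (n : ℕ) (Sinv : Matrix (Fin n) (Fin n) ℝ) (μ₁ : Fin n → ℝ)
    (q : ℝ) (Δ₁ : Matrix (Fin n) (Fin n) ℝ) (Δ₂ : Fin n → ℝ) (Δ₃ : ℝ)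
    (W : Matrix (Fin n) (Fin n) ℝ) (η₀ : ℝ) (η : Fin n → ℝ) :
    Matrix ((Fin n ⊕ Fin n) ⊕ Fin 1) ((Fin n ⊕ Fin n) ⊕ Fin 1) ℝ :=
  -(fromBlocks (fromBlocks Δ₁ 0 0 0) (colBlk (Sum.elim Δ₂ 0))
      (rowBlk (Sum.elim Δ₂ 0)) (sclBlk Δ₃))
  + fromBlocks (fromBlocks 0 0 0 W) (colBlk (Sum.elim 0 (-(W *ᵥ μ₁))))
      (rowBlk (Sum.elim 0 (-(W *ᵥ μ₁)))) (sclBlk (μ₁ ⬝ᵥ (W *ᵥ μ₁) - ∑ i, η i))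
  + η₀ • fromBlocks (fromBlocks Sinv (-Sinv) (-Sinv) Sinv) 0 0 (sclBlk (-q))

theorem Matrix.IsHermitian.dotProduct_mulVec_comm {m : Type*} [Fintype m]
    {M : Matrix m m ℝ} (hM : M.IsHermitian) (u v : m → ℝ) :
    u ⬝ᵥ (M *ᵥ v) = (M *ᵥ u) ⬝ᵥ v := by
  rw [dotProduct_mulVec, ← mulVec_transpose, show Mᵀ = M from hM]

theorem Matrix.PosDef.isUnit_det {m : Type*} [Fintype m] [DecidableEq m]
    {M : Matrix m m ℝ} (hM : M.PosDef) : IsUnit M.det :=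
  (isUnit_iff_isUnit_det M).1 hM.isUnit

/-- The parallel sum `(A⁻¹ + B⁻¹)⁻¹` satisfies the variational bound of an infimal convolution. -/
theorem Matrix.PosDef.dotProduct_inv_add_inv_inv_mulVec_le {m : Type*} [Fintype m]
    [DecidableEq m] {A B : Matrix m m ℝ} (hA : A.PosDef) (hB : B.PosDef) (y z : m → ℝ) :
    (y + z) ⬝ᵥ ((A⁻¹ + B⁻¹)⁻¹ *ᵥ (y + z)) ≤ y ⬝ᵥ (A *ᵥ y) + z ⬝ᵥ (B *ᵥ z) := by
  have hK : (A⁻¹ + B⁻¹).PosDef := hA.inv.add hB.inv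
  obtain ⟨p, hp⟩ : ∃ p, p = (A⁻¹ + B⁻¹)⁻¹ *ᵥ (y + z) := ⟨_, rfl⟩
  have hKp : A⁻¹ *ᵥ p + B⁻¹ *ᵥ p = y + z := by
    rw [← add_mulVec, hp, mulVec_mulVec, mul_nonsing_inv _ hK.isUnit_det, one_mulVec]
  obtain ⟨a, ha⟩ : ∃ a, a = y - A⁻¹ *ᵥ p := ⟨_, rfl⟩
  have hy : y = A⁻¹ *ᵥ p + a := by rw [ha]; abel
  have hz : z = B⁻¹ *ᵥ p - a := by
    rw [ha, sub_sub_eq_add_sub, add_comm, hKp, add_sub_cancel_left]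
  have expand (M : Matrix m m ℝ) (hM : M.PosDef) (b : m → ℝ) :
      (M⁻¹ *ᵥ p + b) ⬝ᵥ (M *ᵥ (M⁻¹ *ᵥ p + b)) =
        p ⬝ᵥ (M⁻¹ *ᵥ p) + 2 * (b ⬝ᵥ p) + b ⬝ᵥ (M *ᵥ b) := by
    have hMp : M *ᵥ (M⁻¹ *ᵥ p) = p := by
      rw [mulVec_mulVec, mul_nonsing_inv _ hM.isUnit_det, one_mulVec]
    rw [mulVec_add, add_dotProduct, dotProduct_add, dotProduct_add,
      hM.isHermitian.dotProduct_mulVec_comm (M⁻¹ *ᵥ p) b, hMp, dotProduct_comm _ p,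
      dotProduct_comm p b]
    ring
  have hAa : 0 ≤ a ⬝ᵥ (A *ᵥ a) := by simpa using hA.posSemidef.dotProduct_mulVec_nonneg a
  have hBa : 0 ≤ (-a) ⬝ᵥ (B *ᵥ (-a)) := by
    simpa using hB.posSemidef.dotProduct_mulVec_nonneg (-a)
  have hpu : (y + z) ⬝ᵥ p = p ⬝ᵥ (A⁻¹ *ᵥ p) + p ⬝ᵥ (B⁻¹ *ᵥ p) := by
    rw [← hKp, dotProduct_comm, dotProduct_add]
  have h₁ := expand A hA a
  have h₂ := expand B hB (-a)
  rw [← hy] at h₁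
  rw [← sub_eq_add_neg, ← hz, neg_dotProduct] at h₂
  rw [← hp, hpu, h₁, h₂]
  linarith

theorem lmiMatrix_isHermitian {n : ℕ} {Sinv Δ₁ W : Matrix (Fin n) (Fin n) ℝ}
    (hS : Sinv.IsHermitian) (hΔ : Δ₁.IsHermitian) (hW : W.IsHermitian) (μ₁ Δ₂ η : Fin n → ℝ)
    (q Δ₃ η₀ : ℝ) : (lmiMatrix n Sinv μ₁ q Δ₁ Δ₂ Δ₃ W η₀ η).IsHermitian := by
  have hS' (i j) : Sinv i j = Sinv j i := hS.apply j i
  have hΔ' (i j) : Δ₁ i j = Δ₁ j i := hΔ.apply j i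
  have hW' (i j) : W i j = W j i := hW.apply j i
  ext ((i | i) | i) ((j | j) | j)
  case inl.inl.inl.inl => simp [lmiMatrix, hS' j i, hΔ' j i]
  case inl.inr.inl.inr => simp [lmiMatrix, hS' j i, hW' j i]
  case inl.inl.inl.inr => simp [lmiMatrix, hS' j i]
  case inl.inr.inl.inl => simp [lmiMatrix, hS' j i]
  all_goals simp [lmiMatrix, colBlk, rowBlk, sclBlk]

theorem lmiMatrix_quadraticForm {n : ℕ} (Sinv Δ₁ W : Matrix (Fin n) (Fin n) ℝ)
    (hW : W.IsHermitian) (μ₁ Δ₂ η : Fin n → ℝ) (q Δ₃ η₀ : ℝ) (θ x : Fin n → ℝ) (t : ℝ) :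
    Sum.elim (Sum.elim θ x) (fun _ => t) ⬝ᵥ
      (lmiMatrix n Sinv μ₁ q Δ₁ Δ₂ Δ₃ W η₀ η *ᵥ Sum.elim (Sum.elim θ x) (fun _ => t)) =
    -(θ ⬝ᵥ (Δ₁ *ᵥ θ) + 2 * t * (Δ₂ ⬝ᵥ θ) + t ^ 2 * Δ₃) +
      ((x - t • μ₁) ⬝ᵥ (W *ᵥ (x - t • μ₁)) - t ^ 2 * ∑ i, η i) +
      η₀ * ((θ - x) ⬝ᵥ (Sinv *ᵥ (θ - x)) - q * t ^ 2) := by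
  have hcol (w : Fin n ⊕ Fin n → ℝ) : colBlk w *ᵥ (fun _ => t) = t • w := by
    ext i; simp [colBlk, mulVec, dotProduct, mul_comm]
  have hrow (w u : Fin n ⊕ Fin n → ℝ) : rowBlk w *ᵥ u = fun _ => w ⬝ᵥ u := by
    ext i; simp [rowBlk, mulVec, dotProduct]
  have hscl (c : ℝ) : sclBlk c *ᵥ (fun _ => t) = fun _ => c * t := by
    ext i; simp [sclBlk, mulVec, dotProduct]
  have hconst (c : ℝ) : (fun _ : Fin 1 => t) ⬝ᵥ (fun _ => c) = t * c := by simp [dotProduct]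
  simp only [lmiMatrix, add_mulVec, neg_mulVec, smul_mulVec, fromBlocks_mulVec,
    Sum.elim_comp_inl, Sum.elim_comp_inr, hcol, hrow, hscl, zero_mulVec, dotProduct_add,
    dotProduct_neg, dotProduct_smul, sumElim_dotProduct_sumElim]
  simp only [mulVec_sub, mulVec_smul, sub_dotProduct, dotProduct_sub, smul_dotProduct,
    dotProduct_smul, smul_eq_mul, hW.dotProduct_mulVec_comm μ₁]
  simp [dotProduct_comm x (W *ᵥ μ₁), dotProduct_comm θ Δ₂, hconst]
  ring

/-- feasibility assertion of Theorem 1 of the paper.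
For every symmetric positive-definite `Σ`, every `μ₁ ∈ ℝⁿ`, `q > 0` and positive
edge lengths `ℓ₁, …, ℓₙ`, there exist a symmetric positive-definite `Δ₁`, a
vector `Δ₂`, and nonnegative scalars `η₀, η₁, …, ηₙ` such that, with
`W = diag(ηᵢ/(ℓᵢ/2)²)` and `Δ₃ = Δ₂ᵀΔ₁⁻¹Δ₂ − 1`, the LMI block matrix (9)
is positive semidefinite. -/
theorem stmt_8 {n : ℕ} (Sig : Matrix (Fin n) (Fin n) ℝ) (hSig : Sig.PosDef)
    (μ₁ : Fin n → ℝ) (q : ℝ) (hq : 0 < q) (ℓ : Fin n → ℝ) (hℓ : ∀ i, 0 < ℓ i) :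
    ∃ (Δ₁ : Matrix (Fin n) (Fin n) ℝ) (Δ₂ : Fin n → ℝ) (η₀ : ℝ) (η : Fin n → ℝ),
      Δ₁.PosDef ∧ 0 ≤ η₀ ∧ (∀ i, 0 ≤ η i) ∧
      (lmiMatrix n Sig⁻¹ μ₁ q Δ₁ Δ₂ (Δ₂ ⬝ᵥ (Δ₁⁻¹ *ᵥ Δ₂) - 1)
        (Matrix.diagonal fun i => η i / (ℓ i / 2) ^ 2) η₀ η).PosSemidef := by
  set η : Fin n → ℝ := fun _ => 1 / (2 * (n + 1)) with hη
  have hη_pos (i) : 0 < η i := by positivity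
  set W : Matrix (Fin n) (Fin n) ℝ := Matrix.diagonal fun i => η i / (ℓ i / 2) ^ 2
  have hW : W.PosDef := by
    refine Matrix.PosDef.diagonal fun i => ?_
    have := hℓ i
    have := hη_pos i
    positivity
  have hS : ((1 / (2 * q)) • Sig⁻¹).PosDef := hSig.inv.smul (by positivity)
  set P := (W⁻¹ + ((1 / (2 * q)) • Sig⁻¹)⁻¹)⁻¹ with hPdef
  have hP : P.PosDef := (hW.inv.add hS.inv).inv
  have hηsum : ∑ i, η i ≤ 1 / 2 := by
    simp only [hη, sum_const, card_univ, Fintype.card_fin, nsmul_eq_mul]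
    rw [mul_one_div, div_le_div_iff₀ (by positivity) (by norm_num)]
    linarith
  refine ⟨P, -(P *ᵥ μ₁), 1 / (2 * q), η, hP, by positivity, fun i => (hη_pos i).le, ?_⟩
  refine .of_dotProduct_mulVec_nonneg (lmiMatrix_isHermitian hSig.inv.isHermitian
    hP.isHermitian hW.isHermitian _ _ _ _ _ _) fun v => ?_
  obtain ⟨θ, x, t, rfl⟩ : ∃ (θ x : Fin n → ℝ) (t : ℝ),
      v = Sum.elim (Sum.elim θ x) (fun _ => t) :=
    ⟨v ∘ .inl ∘ .inl, v ∘ .inl ∘ .inr, v (.inr 0), by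
      ext ((i | i) | i)
      · rfl
      · rfl
      · simp [Subsingleton.elim i 0]⟩
  rw [star_trivial, lmiMatrix_quadraticForm _ _ _ hW.isHermitian]
  have hmain := hW.dotProduct_inv_add_inv_inv_mulVec_le hS (x - t • μ₁) (θ - x)
  rw [← hPdef, show x - t • μ₁ + (θ - x) = θ - t • μ₁ by abel, smul_mulVec,
    dotProduct_smul, smul_eq_mul] at hmain
  have hcenter : -(P *ᵥ μ₁) ⬝ᵥ (P⁻¹ *ᵥ -(P *ᵥ μ₁)) = μ₁ ⬝ᵥ (P *ᵥ μ₁) := by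
    rw [mulVec_neg, mulVec_mulVec, nonsing_inv_mul _ hP.isUnit_det, one_mulVec,
      neg_dotProduct_neg, dotProduct_comm]
  have hsquare : (θ - t • μ₁) ⬝ᵥ (P *ᵥ (θ - t • μ₁)) =
      θ ⬝ᵥ (P *ᵥ θ) - 2 * t * ((P *ᵥ μ₁) ⬝ᵥ θ) + t ^ 2 * (μ₁ ⬝ᵥ (P *ᵥ μ₁)) := by
    simp only [mulVec_sub, mulVec_smul, sub_dotProduct, dotProduct_sub, smul_dotProduct,
      dotProduct_smul, smul_eq_mul, hP.isHermitian.dotProduct_mulVec_comm μ₁,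
      dotProduct_comm θ (P *ᵥ μ₁)]
    ring
  have hq' : 1 / (2 * q) * (q * t ^ 2) = t ^ 2 / 2 := by field_simp
  rw [hcenter, neg_dotProduct, mul_sub (1 / (2 * q)), hq']
  nlinarith [mul_le_mul_of_nonneg_left hηsum (sq_nonneg t)]
end

section
/- Let Σ ∈ ℝ^{n×n} be symmetric positive definite, μ₁ ∈ ℝ^{n}, q > 0, ℓ_1, …, ℓ_n > 0, let Δ₁ ∈ ℝ^{n×n} be symmetric positive definite, Δ₂ ∈ ℝ^{n}, η₀, η₁, …, η_n ≥ 0, set W = diag(η_1/(ℓ_1/2)², …, η_n/(ℓ_n/2)²) and Δ₃ = Δ₂ᵀΔ₁^{-1}Δ₂ − 1, and suppose the symmetric block matrix −[[Δ₁, 0, Δ₂],[0, 0, 0],[Δ₂ᵀ, 0, Δ₃]] + [[0, 0, 0],[0, W, −Wμ₁],[0, −μ₁ᵀW, μ₁ᵀWμ₁ − ∑_{i=1}^{n} η_i]] + η₀[[Σ^{-1}, −Σ^{-1}, 0],[−Σ^{-1}, Σ^{-1}, 0],[0, 0, −q]] is positive semidefinite. Then for every θ ∈ ℝ^{n} of the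 form θ = θ₀ + μ, where θ₀ᵀΣ^{-1}θ₀ ≤ q and |μ[i] − μ₁[i]| ≤ ℓ_i/2 for all i = 1, …, n, it holds that θᵀΔ₁θ + 2Δ₂ᵀθ + Δ₃ ≤ 0. -/
open Matrix Finset

theorem lmiMatrix_quadratic_form (n : ℕ) (Sinv : Matrix (Fin n) (Fin n) ℝ) (μ₁ : Fin n → ℝ)
    (q : ℝ) (Δ₁ : Matrix (Fin n) (Fin n) ℝ) (Δ₂ : Fin n → ℝ) (Δ₃ : ℝ)
    (W : Matrix (Fin n) (Fin n) ℝ) (η₀ : ℝ) (η θ μ : Fin n → ℝ) :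
    Sum.elim (Sum.elim θ μ) 1 ⬝ᵥ
        (lmiMatrix n Sinv μ₁ q Δ₁ Δ₂ Δ₃ W η₀ η *ᵥ Sum.elim (Sum.elim θ μ) 1) =
      -(θ ⬝ᵥ (Δ₁ *ᵥ θ) + 2 * (Δ₂ ⬝ᵥ θ) + Δ₃)
      + (μ ⬝ᵥ (W *ᵥ μ) - 2 * (μ ⬝ᵥ (W *ᵥ μ₁)) + μ₁ ⬝ᵥ (W *ᵥ μ₁) - ∑ i, η i)
      + η₀ * ((θ - μ) ⬝ᵥ (Sinv *ᵥ (θ - μ)) - q) := by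
  have colBlk_mulVec {m : Type} (v : m → ℝ) : colBlk v *ᵥ 1 = v := by
    ext i; simp [colBlk, mulVec, dotProduct]
  have rowBlk_mulVec {m : Type} [Fintype m] (v w : m → ℝ) :
      rowBlk v *ᵥ w = fun _ => v ⬝ᵥ w := by
    ext i; simp [rowBlk, mulVec]
  have sclBlk_mulVec (c : ℝ) : sclBlk c *ᵥ 1 = fun _ => c := by
    ext i; simp [sclBlk, mulVec, dotProduct]
  have one_dotProduct (w : Fin 1 → ℝ) : 1 ⬝ᵥ w = w 0 := by simp [dotProduct]
  simp only [lmiMatrix, add_mulVec, neg_mulVec, smul_mulVec, fromBlocks_mulVec,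
    Sum.elim_comp_inl, Sum.elim_comp_inr, colBlk_mulVec, rowBlk_mulVec, sclBlk_mulVec,
    dotProduct_add, dotProduct_neg, dotProduct_smul, sumElim_dotProduct_sumElim,
    one_dotProduct, Pi.add_apply, zero_mulVec, dotProduct_zero, zero_dotProduct,
    mulVec_sub, sub_dotProduct, dotProduct_sub, neg_dotProduct, smul_eq_mul, Pi.zero_apply]
  rw [dotProduct_comm θ Δ₂, dotProduct_comm (W *ᵥ μ₁) μ]
  ring

/-- containment / S-procedure step in the proof of Theorem 1
of the paper. If the LMI block matrix (9) (with `W = diag(ηᵢ/(ℓᵢ/2)²)` and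
`Δ₃ = Δ₂ᵀΔ₁⁻¹Δ₂ − 1`) is positive semidefinite, then every
`θ = θ₀ + μ` with `θ₀ᵀΣ⁻¹θ₀ ≤ q` and `|μ[i] − μ₁[i]| ≤ ℓᵢ/2` for all `i`
satisfies `θᵀΔ₁θ + 2Δ₂ᵀθ + Δ₃ ≤ 0`. -/
theorem stmt_9 {n : ℕ} (Sig : Matrix (Fin n) (Fin n) ℝ) (hSig : Sig.PosDef)
    (μ₁ : Fin n → ℝ) (q : ℝ) (hq : 0 < q) (ℓ : Fin n → ℝ) (hℓ : ∀ i, 0 < ℓ i)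
    (Δ₁ : Matrix (Fin n) (Fin n) ℝ) (hΔ₁ : Δ₁.PosDef) (Δ₂ : Fin n → ℝ)
    (η₀ : ℝ) (hη₀ : 0 ≤ η₀) (η : Fin n → ℝ) (hη : ∀ i, 0 ≤ η i)
    (hLMI : (lmiMatrix n Sig⁻¹ μ₁ q Δ₁ Δ₂ (Δ₂ ⬝ᵥ (Δ₁⁻¹ *ᵥ Δ₂) - 1)
      (Matrix.diagonal fun i => η i / (ℓ i / 2) ^ 2) η₀ η).PosSemidef) :
    ∀ θ θ₀ μ : Fin n → ℝ, θ = θ₀ + μ → θ₀ ⬝ᵥ (Sig⁻¹ *ᵥ θ₀) ≤ q →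
      (∀ i, |μ i - μ₁ i| ≤ ℓ i / 2) →
      θ ⬝ᵥ (Δ₁ *ᵥ θ) + 2 * (Δ₂ ⬝ᵥ θ) + (Δ₂ ⬝ᵥ (Δ₁⁻¹ *ᵥ Δ₂) - 1) ≤ 0 := by
  rintro θ θ₀ μ rfl hθ₀ hμ
  have hquad := hLMI.dotProduct_mulVec_nonneg (Sum.elim (Sum.elim (θ₀ + μ) μ) 1)
  rw [star_trivial, lmiMatrix_quadratic_form, add_sub_cancel_right] at hquad
  have hbox : μ ⬝ᵥ (Matrix.diagonal (fun i => η i / (ℓ i / 2) ^ 2) *ᵥ μ)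
      - 2 * (μ ⬝ᵥ (Matrix.diagonal (fun i => η i / (ℓ i / 2) ^ 2) *ᵥ μ₁))
      + μ₁ ⬝ᵥ (Matrix.diagonal (fun i => η i / (ℓ i / 2) ^ 2) *ᵥ μ₁) ≤ ∑ i, η i := by
    simp only [dotProduct, mulVec_diagonal, Finset.mul_sum, ← Finset.sum_sub_distrib,
      ← Finset.sum_add_distrib]
    refine Finset.sum_le_sum fun i _ => ?_
    have hpos : 0 < (ℓ i / 2) ^ 2 := by have := hℓ i; positivity
    have hsq : (μ i - μ₁ i) ^ 2 ≤ (ℓ i / 2) ^ 2 :=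
      sq_le_sq' (abs_le.mp (hμ i)).1 (abs_le.mp (hμ i)).2
    calc _ = η i / (ℓ i / 2) ^ 2 * (μ i - μ₁ i) ^ 2 := by ring
      _ ≤ η i / (ℓ i / 2) ^ 2 * (ℓ i / 2) ^ 2 :=
        mul_le_mul_of_nonneg_left hsq (div_nonneg (hη i) hpos.le)
      _ = η i := div_mul_cancel₀ _ hpos.ne'
  have hell := mul_nonpos_of_nonneg_of_nonpos hη₀ (sub_nonpos.mpr hθ₀)
  linarith
end

section
/- Let T ∈ ℝ^{m×m} be a diagonal matrix with all diagonal entries nonzero, let Δ₁ ∈ ℝ^{p×p}, Δ₂ ∈ ℝ^{p×r}, Δ₃ ∈ ℝ^{r×r} with Δ₁ and Δ₃ symmetric, and suppose [[Δ₁, Δ₂],[Δ₂ᵀ, Δ₃]] is invertible with inverse [[Δ̃₁, Δ̃₂],[Δ̃₂ᵀ, Δ̃₃]] (Δ̃₁ ∈ ℝ^{p×p}, Δ̃₂ ∈ ℝ^{p×r}, Δ̃₃ ∈ ℝ^{r×r}). Then the block matrix [[T ⊗ Δ₃, −(T ⊗ Δ₂)ᵀ],[−(T ⊗ Δ₂),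 T ⊗ Δ₁]] is invertible and its inverse is [[T^{-1} ⊗ Δ̃₃, −(T^{-1} ⊗ Δ̃₂)ᵀ],[−(T^{-1} ⊗ Δ̃₂), T^{-1} ⊗ Δ̃₁]]. -/
open Matrix
open scoped Kronecker

/-- If `S * S' = 1` with `S`, `S'` symmetric, the identity
`[[A, B], [Bᵀ, C]] * [[A', B'], [B'ᵀ, C']] = 1` lifts to the Kronecker products of the
block-swapped, off-diagonally negated matrices with `S` and `S'`. -/
theorem fromBlocks_kronecker_swap_mul_eq_one {R n p r : Type*} [CommRing R]
    [Fintype n] [DecidableEq n] [Fintype p] [DecidableEq p] [Fintype r] [DecidableEq r]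
    {S S' : Matrix n n R} (hS : S.IsSymm) (hS' : S'.IsSymm) (hSS' : S * S' = 1)
    {A A' : Matrix p p R} {B B' : Matrix p r R} {C C' : Matrix r r R}
    (h : fromBlocks A B Bᵀ C * fromBlocks A' B' B'ᵀ C' = 1) :
    fromBlocks (S ⊗ₖ C) (-(S ⊗ₖ B)ᵀ) (-(S ⊗ₖ B)) (S ⊗ₖ A) *
      fromBlocks (S' ⊗ₖ C') (-(S' ⊗ₖ B')ᵀ) (-(S' ⊗ₖ B')) (S' ⊗ₖ A') = 1 := by
  rw [fromBlocks_multiply, ← fromBlocks_one, fromBlocks_inj] at h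
  obtain ⟨h₁₁, h₁₂, h₂₁, h₂₂⟩ := h
  rw [fromBlocks_multiply, ← fromBlocks_one, fromBlocks_inj]
  simp only [← kroneckerMap_transpose, hS.eq, hS'.eq, Matrix.neg_mul, Matrix.mul_neg, neg_neg,
    ← mul_kronecker_mul, hSS', ← neg_add, ← kronecker_add]
  refine ⟨?_, ?_, ?_, ?_⟩
  · rw [add_comm, h₂₂, one_kronecker_one]
  · rw [add_comm, h₂₁, kronecker_zero, neg_zero]
  · rw [add_comm, h₁₂, kronecker_zero, neg_zero]
  · rw [add_comm, h₁₁, one_kronecker_one]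

/-- Kronecker block-inverse identity from the proof of
Theorem 2 of the paper. Let `T = diag(d)` with all `d i ≠ 0`, let `Δ₁, Δ₃` be
symmetric, and suppose `[[Δ₁, Δ₂],[Δ₂ᵀ, Δ₃]]` is invertible with inverse
`[[Δ̃₁, Δ̃₂],[Δ̃₂ᵀ, Δ̃₃]]`. Then `[[T ⊗ Δ₃, −(T ⊗ Δ₂)ᵀ],[−(T ⊗ Δ₂), T ⊗ Δ₁]]`
is invertible with inverse
`[[T⁻¹ ⊗ Δ̃₃, −(T⁻¹ ⊗ Δ̃₂)ᵀ],[−(T⁻¹ ⊗ Δ̃₂), T⁻¹ ⊗ Δ̃₁]]`, where `T⁻¹` is the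
diagonal matrix of reciprocal diagonal entries. -/
theorem stmt_13 {m p r : ℕ} (d : Fin m → ℝ) (hd : ∀ i, d i ≠ 0)
    (T : Matrix (Fin m) (Fin m) ℝ) (hT : T = Matrix.diagonal d)
    (Δ₁ : Matrix (Fin p) (Fin p) ℝ) (Δ₂ : Matrix (Fin p) (Fin r) ℝ)
    (Δ₃ : Matrix (Fin r) (Fin r) ℝ) (hΔ₁ : Δ₁.IsSymm) (hΔ₃ : Δ₃.IsSymm)
    (Δt₁ : Matrix (Fin p) (Fin p) ℝ) (Δt₂ : Matrix (Fin p) (Fin r) ℝ)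
    (Δt₃ : Matrix (Fin r) (Fin r) ℝ)
    (h₁ : fromBlocks Δ₁ Δ₂ Δ₂ᵀ Δ₃ * fromBlocks Δt₁ Δt₂ Δt₂ᵀ Δt₃ = 1)
    (h₂ : fromBlocks Δt₁ Δt₂ Δt₂ᵀ Δt₃ * fromBlocks Δ₁ Δ₂ Δ₂ᵀ Δ₃ = 1) :
    fromBlocks (T ⊗ₖ Δ₃) (-(T ⊗ₖ Δ₂)ᵀ) (-(T ⊗ₖ Δ₂)) (T ⊗ₖ Δ₁) *
        fromBlocks ((Matrix.diagonal fun i => (d i)⁻¹) ⊗ₖ Δt₃)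
          (-((Matrix.diagonal fun i => (d i)⁻¹) ⊗ₖ Δt₂)ᵀ)
          (-((Matrix.diagonal fun i => (d i)⁻¹) ⊗ₖ Δt₂))
          ((Matrix.diagonal fun i => (d i)⁻¹) ⊗ₖ Δt₁) = 1 ∧
      fromBlocks ((Matrix.diagonal fun i => (d i)⁻¹) ⊗ₖ Δt₃)
          (-((Matrix.diagonal fun i => (d i)⁻¹) ⊗ₖ Δt₂)ᵀ)
          (-((Matrix.diagonal fun i => (d i)⁻¹) ⊗ₖ Δt₂))
          ((Matrix.diagonal fun i => (d i)⁻¹) ⊗ₖ Δt₁) *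
        fromBlocks (T ⊗ₖ Δ₃) (-(T ⊗ₖ Δ₂)ᵀ) (-(T ⊗ₖ Δ₂)) (T ⊗ₖ Δ₁) = 1 := by
  subst hT
  have hdi : Matrix.diagonal d * Matrix.diagonal (fun i => (d i)⁻¹) = 1 := by
    simp [hd]
  have hid : Matrix.diagonal (fun i => (d i)⁻¹) * Matrix.diagonal d = 1 := by
    simp [hd]
  exact ⟨fromBlocks_kronecker_swap_mul_eq_one (isSymm_diagonal _) (isSymm_diagonal _) hdi h₁,
    fromBlocks_kronecker_swap_mul_eq_one (isSymm_diagonal _) (isSymm_diagonal _) hid h₂⟩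
end
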